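/- Let A be a badly approximable s-dimensional affine subspace of ℝⁿ. Then for every ξ ∈ A, the ordinary simultaneous Diophantine exponent satisfies ω(ξ) ≤ (s+1)/(n-s). -/

import Mathlib

/-- The distance from a real number to the nearest integer. -/
noncomputable def distZ (x : ℝ) : ℝ := |x - round x|

/-- For every `ξ` on a badly approximable `s`-dimensional affine subspace
`A = {(x, y₀ + Yx)}` of `ℝⁿ` (`n = s + m`), the ordinary simultaneous Diophantine
exponent satisfies `ω(ξ) ≤ (s+1)/(n-s)`. -/
theorem badly_approximable_ordinary_exponent_le (s m : ℕ) (hm : 0 < m)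
    (Y : Matrix (Fin m) (Fin s) ℝ) (y₀ : Fin m → ℝ)
    (hbad : ∃ ε : ℝ, 0 < ε ∧ ∀ q : Fin (s + 1) → ℤ, q ≠ 0 →
      ∃ i : Fin m, ε ≤
        (((Finset.univ.sup fun j => (q j).natAbs) : ℕ) : ℝ) ^ (((s : ℝ) + 1) / m) *
          distZ ((Matrix.of fun i j => Fin.cases (y₀ i) (fun j' => Y i j') j).mulVec
            (fun j => (q j : ℝ)) i))
    (x : Fin s → ℝ) :
    ∀ γ : ℝ, 0 < γ →
      (∀ Q : ℕ, ∃ q : ℕ, Q ≤ q ∧ 0 < q ∧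
        ∀ j : Fin (s + m),
          distZ ((q : ℝ) * Fin.append x (y₀ + Y.mulVec x) j) < (q : ℝ) ^ (-γ)) →
      γ ≤ ((s : ℝ) + 1) / m := by
  obtain ⟨ε, hε, hb⟩ := hbad
  intro γ hγ h
  by_contra hlt
  push Not at hlt
  set τ : ℝ := ((s : ℝ) + 1) / m with hτ
  have hτ0 : 0 ≤ τ := by positivity
  set C : ℝ := 2 + ∑ j, |x j| with hC
  set D : ℝ := 1 + ∑ i, ∑ j, |Y i j| with hD
  have hC0 : 0 < C := by positivity
  have hD0 : 0 < D := by positivity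
  have key : Filter.Tendsto (fun q : ℕ => C ^ τ * D * (q : ℝ) ^ (-(γ - τ))) Filter.atTop
      (nhds (C ^ τ * D * 0)) :=
    ((tendsto_rpow_neg_atTop (sub_pos.2 hlt)).comp tendsto_natCast_atTop_atTop).const_mul _
  rw [mul_zero] at key
  obtain ⟨Q, hQ⟩ := Filter.eventually_atTop.1 (key.eventually (gt_mem_nhds hε))
  obtain ⟨q, hQq, hq, hap⟩ := h Q
  have hsmall := hQ q hQq
  have hq1 : (1 : ℝ) ≤ q := by exact_mod_cast hq
  have hq0 : (0 : ℝ) < q := by linarith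
  have hpow1 : (q : ℝ) ^ (-γ) ≤ 1 := Real.rpow_le_one_of_one_le_of_nonpos hq1 (by linarith)
  have hpow0 : (0 : ℝ) < (q : ℝ) ^ (-γ) := Real.rpow_pos_of_pos hq0 _
  have hx : ∀ j, |q * x j - round (q * x j)| < (q : ℝ) ^ (-γ) := by
    intro j
    have := hap (Fin.castAdd m j)
    rwa [Fin.append_left] at this
  have hy : ∀ i, |q * (y₀ i + ∑ j, Y i j * x j) - round (q * (y₀ i + ∑ j, Y i j * x j))|
      < (q : ℝ) ^ (-γ) := by
    intro i
    have := hap (Fin.natAdd s i)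
    rwa [Fin.append_right] at this
  let v : Fin (s + 1) → ℤ := Fin.cons (q : ℤ) (fun j => round (q * x j))
  have hv0 : v 0 = q := rfl
  have hvs : ∀ j : Fin s, v j.succ = round (q * x j) := fun j => rfl
  have hv : v ≠ 0 := by
    intro h0
    have := congrFun h0 0
    rw [hv0] at this
    simp at this
    omega
  obtain ⟨i, hi⟩ := hb v hv
  have hH : (((Finset.univ.sup fun j => (v j).natAbs) : ℕ) : ℝ) ≤ C * q := by
    obtain ⟨j, -, hj⟩ := Finset.exists_mem_eq_sup Finset.univ Finset.univ_nonempty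
      (fun j => (v j).natAbs)
    rw [hj, Nat.cast_natAbs, Int.cast_abs]
    have hS : 0 ≤ ∑ j, |x j| := by positivity
    refine Fin.cases ?_ (fun j => ?_) j
    · rw [hv0]
      simp only [Int.cast_natCast, Nat.abs_cast]
      nlinarith
    · rw [hvs]
      have h1 := abs_le.1 ((hx j).le.trans hpow1)
      have h2 : |x j| ≤ ∑ j, |x j| :=
        Finset.single_le_sum (f := fun j => |x j|) (fun _ _ => abs_nonneg _) (Finset.mem_univ j)
      have h3 : |(round (q * x j) : ℝ)| ≤ |q * x j| + 1 := by
        have h4 := le_abs_self (q * x j)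
        have h5 := neg_abs_le (q * x j)
        rw [abs_le]
        constructor <;> linarith
      rw [abs_mul, abs_of_pos hq0] at h3
      nlinarith
  have hz : distZ ((Matrix.of fun i j => Fin.cases (y₀ i) (fun j' => Y i j') j).mulVec
            (fun j => (v j : ℝ)) i) ≤ D * (q : ℝ) ^ (-γ) := by
    have hmv : (Matrix.of fun i j => Fin.cases (y₀ i) (fun j' => Y i j') j).mulVec
            (fun j => (v j : ℝ)) i = y₀ i * q + ∑ j, Y i j * round (q * x j) := by
      simp [Matrix.mulVec, dotProduct, Fin.sum_univ_succ, hv0, hvs]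
    rw [hmv]
    unfold distZ
    refine (round_le _ (round (q * (y₀ i + ∑ j, Y i j * x j)))).trans ?_
    have hyi := hy i
    set R : ℝ := ((round (q * (y₀ i + ∑ j, Y i j * x j)) : ℤ) : ℝ)
    have e : y₀ i * q + ∑ j, Y i j * round (q * x j) - R
        = (q * (y₀ i + ∑ j, Y i j * x j) - R) - ∑ j, Y i j * (q * x j - round (q * x j)) := by
      simp only [mul_sub, Finset.sum_sub_distrib, mul_add, Finset.mul_sum]
      have : ∀ j, Y i j * (q * x j) = q * (Y i j * x j) := fun j => by ring
      simp only [this]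
      ring
    rw [e]
    have h1 : |∑ j, Y i j * (q * x j - round (q * x j))| ≤ (∑ j, |Y i j|) * (q : ℝ) ^ (-γ) := by
      refine (Finset.abs_sum_le_sum_abs _ _).trans ?_
      rw [Finset.sum_mul]
      refine Finset.sum_le_sum fun j _ => ?_
      rw [abs_mul]
      exact mul_le_mul_of_nonneg_left (hx j).le (abs_nonneg _)
    have h2 : ∑ j, |Y i j| ≤ ∑ i, ∑ j, |Y i j| :=
      Finset.single_le_sum (f := fun i => ∑ j, |Y i j|)
        (fun _ _ => Finset.sum_nonneg fun _ _ => abs_nonneg _) (Finset.mem_univ i)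
    refine (abs_sub _ _).trans ?_
    rw [hD]
    nlinarith
  have hfin : ε ≤ (C * q) ^ τ * (D * (q : ℝ) ^ (-γ)) := by
    refine hi.trans (mul_le_mul (Real.rpow_le_rpow (Nat.cast_nonneg _) hH hτ0) hz ?_ ?_)
    · exact abs_nonneg _
    · positivity
  have e2 : (C * q) ^ τ * (D * (q : ℝ) ^ (-γ)) = C ^ τ * D * (q : ℝ) ^ (-(γ - τ)) := by
    rw [Real.mul_rpow hC0.le hq0.le, show -(γ - τ) = τ + -γ by ring, Real.rpow_add hq0]
    ring
  linarith
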